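/- For any entangled bipartite state ρ_e, not all steered states of Bob can be simultaneously diagonal in a single orthonormal basis: there exist POVM elements M₁, M₂ such that the steered states ρ_B^{M₁} and ρ_B^{M₂} do not commute. Equivalently, if every steered state of ρ is diagonal in a fixed basis {|ξ_i⟩}, then ρ is separable (indeed B-classical). -/

import Mathlib

open Matrix BigOperators Kronecker ComplexOrder

noncomputable section

def ptraceA {dA dB : ℕ} (ρ : Matrix (Fin dA × Fin dB) (Fin dA × Fin dB) ℂ) :
    Matrix (Fin dB) (Fin dB) ℂ :=
  fun j j' => ∑ a, ρ (a, j) (a, j')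

def proj {n : Type*} [Fintype n] (x : n → ℂ) : Matrix n n ℂ :=
  vecMulVec x (star x)


def VV (dA : ℕ) {dB : ℕ} (x : Fin dB → ℂ) : Matrix (Fin dA × Fin dB) (Fin dA) ℂ :=
  fun q a => if q.1 = a then x q.2 else 0

lemma VV_conj {dA dB : ℕ} (x : Fin dB → ℂ) (R : Matrix (Fin dA) (Fin dA) ℂ) :
    VV dA x * R * (VV dA x)ᴴ = R ⊗ₖ proj x := by
  ext ⟨a, b⟩ ⟨a', b'⟩
  simp [VV, Matrix.mul_apply, proj, vecMulVec_apply, apply_ite, ite_mul, mul_ite]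
  ring

lemma VV_key {dA dB : ℕ} (ρ : Matrix (Fin dA × Fin dB) (Fin dA × Fin dB) ℂ)
    (M : Matrix (Fin dA) (Fin dA) ℂ) (x y : Fin dB → ℂ) :
    star x ⬝ᵥ (ptraceA ((M ⊗ₖ 1) * ρ) *ᵥ y) = (M * ((VV dA x)ᴴ * ρ * VV dA y)).trace := by
  simp only [VV, Matrix.trace, Matrix.diag, Matrix.mul_apply, ptraceA, dotProduct, mulVec,
    Fintype.sum_prod_type, kroneckerMap_apply, Matrix.one_apply, conjTranspose_apply, apply_ite,
    ite_mul, mul_ite, star_zero, zero_mul, mul_zero, mul_one, Finset.sum_ite_eq,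
    Finset.sum_ite_eq', Finset.mem_univ, if_true, Pi.star_apply, Finset.sum_mul, Finset.mul_sum]
  have e : ∀ b a c b', star (x b) * (M a c * ρ (c, b) (a, b') * y b')
      = M a c * (star (x b) * ρ (c, b) (a, b') * y b') := by intros; ring
  simp only [Finset.sum_ite_irrel, Finset.sum_const_zero, Finset.sum_ite_eq,
    Finset.sum_ite_eq', Finset.mem_univ, if_true, e]
  rw [Finset.sum_comm]
  have r : ∀ {T : Type} [Fintype T] (f : T → Fin dA → Fin dA → ℂ),
      ∑ i, ∑ k, ∑ l, f i k l = ∑ k, ∑ l, ∑ i, f i k l := by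
    intro T _ f
    rw [Finset.sum_comm]
    exact Finset.sum_congr rfl fun k _ => Finset.sum_comm
  rw [← r]
  exact Finset.sum_congr rfl fun j _ => r _

lemma VV_sum {dA dB : ℕ} (ξ : Fin dB → (Fin dB → ℂ))
    (horth : ∀ i j, star (ξ i) ⬝ᵥ ξ j = if i = j then (1 : ℂ) else 0) :
    ∑ i, VV dA (ξ i) * (VV dA (ξ i))ᴴ = 1 := by
  have h1 : (Matrix.of ξ).map star * (Matrix.of ξ)ᵀ = 1 := by
    ext i j
    simpa [Matrix.mul_apply, dotProduct, Matrix.one_apply] using horth i j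
  have h2 := mul_eq_one_comm.mp h1
  ext ⟨a, b⟩ ⟨a', b'⟩
  have h3 := congrFun (congrFun h2 b) b'
  simp only [Matrix.mul_apply, Matrix.transpose_apply, Matrix.of_apply, Matrix.map_apply] at h3
  simp only [Matrix.sum_apply, VV, Matrix.mul_apply, conjTranspose_apply, apply_ite,
    ite_mul, mul_ite, star_zero, zero_mul, mul_zero, Finset.sum_ite_eq,
    Finset.sum_ite_eq', Finset.mem_univ, if_true, Finset.sum_ite_irrel, Finset.sum_const_zero, h3]
  by_cases h : a = a' <;> by_cases h' : b = b' <;> simp [Matrix.one_apply, h, h', eq_comm]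

lemma quad_zero {n : ℕ} (R : Matrix (Fin n) (Fin n) ℂ)
    (h : ∀ v : Fin n → ℂ, star v ⬝ᵥ (R *ᵥ v) = 0) : R = 0 := by
  have : Matrix.toEuclideanLin R = 0 := by
    rw [← inner_map_self_eq_zero]
    intro v
    have := h v.ofLp
    rw [EuclideanSpace.inner_eq_star_dotProduct, ← star_eq_zero, ← dotProduct_star]
    simpa [dotProduct_comm] using this
  simpa using this

lemma R_zero {n : ℕ} (R : Matrix (Fin n) (Fin n) ℂ)
    (h : ∀ M : Matrix (Fin n) (Fin n) ℂ, M.PosSemidef → (1 - M).PosSemidef →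
      (M * R).trace = 0) : R = 0 := by
  apply quad_zero
  intro v
  by_cases hv : v = 0
  · simp [hv]
  have hc : star v ⬝ᵥ v ≠ 0 := by simpa using hv
  set c := star v ⬝ᵥ v with hcd
  have hcs : star c = c := by rw [hcd, ← star_dotProduct]
  set P : Matrix (Fin n) (Fin n) ℂ := c⁻¹ • vecMulVec v (star v) with hP
  have hPh : Pᴴ = P := by
    rw [hP, conjTranspose_smul, conjTranspose_vecMulVec, star_star, star_inv₀, hcs]
  have hPP : P * P = P := by
    rw [hP, smul_mul_smul_comm, vecMulVec_mul_vecMulVec, ← hcd, vecMulVec_smul, smul_smul]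
    congr 1
    field_simp
  have h1 : P.PosSemidef := by
    have := posSemidef_conjTranspose_mul_self P
    rwa [hPh, hPP] at this
  have h2 : (1 - P).PosSemidef := by
    have := posSemidef_conjTranspose_mul_self (1 - P)
    rwa [conjTranspose_sub, conjTranspose_one, hPh, 
      show (1 - P) * (1 - P) = 1 - P - P + P * P by noncomm_ring, hPP, sub_add_cancel] at this
  have := h P h1 h2
  rw [hP, smul_mul, trace_smul, smul_eq_zero, vecMulVec_mul, trace_vecMulVec] at this
  have := this.resolve_left (inv_ne_zero hc)
  rw [dotProduct_comm] at this
  rwa [dotProduct_mulVec]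

/-- contrapositive form: if every steered state of ρ is diagonal in
a fixed orthonormal basis {ξ_i}, then ρ is B-classical (hence separable). -/
theorem stmt18 {dA dB : ℕ}
    (ρ : Matrix (Fin dA × Fin dB) (Fin dA × Fin dB) ℂ)
    (hρ : ρ.PosSemidef ∧ ρ.trace = 1)
    (ξ : Fin dB → (Fin dB → ℂ))
    (horth : ∀ i j, star (ξ i) ⬝ᵥ ξ j = if i = j then (1 : ℂ) else 0)
    (hdiag : ∀ M : Matrix (Fin dA) (Fin dA) ℂ,
      M.PosSemidef → ((1 : Matrix (Fin dA) (Fin dA) ℂ) - M).PosSemidef →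
      0 < (((M ⊗ₖ (1 : Matrix (Fin dB) (Fin dB) ℂ)) * ρ).trace).re →
      ∀ i j, i ≠ j → star (ξ i) ⬝ᵥ (ptraceA ((M ⊗ₖ 1) * ρ) *ᵥ ξ j) = 0) :
    ∃ (p : Fin dB → ℝ) (ρA : Fin dB → Matrix (Fin dA) (Fin dA) ℂ),
      (∀ i, 0 ≤ p i) ∧ (∑ i, p i = 1) ∧
      (∀ i, (ρA i).PosSemidef ∧ (ρA i).trace = 1) ∧
      ρ = ∑ i, (p i : ℂ) • (ρA i ⊗ₖ proj (ξ i)) := by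
  obtain ⟨hpsd, htr⟩ := hρ
  set R : Fin dB → Fin dB → Matrix (Fin dA) (Fin dA) ℂ :=
    fun i j => (VV dA (ξ i))ᴴ * ρ * VV dA (ξ j) with hR
  have hoff : ∀ i j, i ≠ j → R i j = 0 := by
    intro i j hij
    have key : ∀ M : Matrix (Fin dA) (Fin dA) ℂ,
      M.PosSemidef → ((1 : Matrix (Fin dA) (Fin dA) ℂ) - M).PosSemidef →
      0 < (((M ⊗ₖ (1 : Matrix (Fin dB) (Fin dB) ℂ)) * ρ).trace).re → (M * R i j).trace = 0 := by
      intro M h1 h2 h3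
      rw [← hdiag M h1 h2 h3 i j hij, VV_key]
    have k1 : (R i j).trace = 0 := by
      have := key 1 PosSemidef.one (by simpa using PosSemidef.zero) (by simp [htr])
      simpa using this
    apply R_zero
    intro M h1 h2
    by_cases h3 : 0 < (((M ⊗ₖ (1 : Matrix (Fin dB) (Fin dB) ℂ)) * ρ).trace).re
    · exact key M h1 h2 h3
    · have e : (1 - M) ⊗ₖ (1 : Matrix (Fin dB) (Fin dB) ℂ) = 1 - M ⊗ₖ 1 := by
        rw [← one_kronecker_one]
        ext ⟨a, b⟩ ⟨a', b'⟩
        simp only [kroneckerMap_apply, Matrix.sub_apply, sub_mul]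
      have := key (1 - M) h2 (by simpa using h1) (by
        rw [e, sub_mul, one_mul, trace_sub, htr, Complex.sub_re, Complex.one_re]; linarith)
      rw [sub_mul, one_mul, trace_sub, k1, zero_sub, neg_eq_zero] at this
      exact this
  have hdec : ρ = ∑ i, R i i ⊗ₖ proj (ξ i) := by
    have hs := VV_sum (dA := dA) ξ horth
    calc ρ = (∑ i, VV dA (ξ i) * (VV dA (ξ i))ᴴ) * ρ * (∑ j, VV dA (ξ j) * (VV dA (ξ j))ᴴ) := by
            rw [hs, one_mul, mul_one]
      _ = ∑ i, ∑ j, VV dA (ξ i) * R i j * (VV dA (ξ j))ᴴ := by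
            simp only [Finset.sum_mul, Finset.mul_sum, hR, Matrix.mul_assoc]
            try rw [Finset.sum_comm]
      _ = ∑ i, VV dA (ξ i) * R i i * (VV dA (ξ i))ᴴ := by
            refine Finset.sum_congr rfl fun i _ => ?_
            refine Finset.sum_eq_single i (fun j _ hj => ?_) (by simp)
            rw [hoff i j hj.symm]; simp
      _ = _ := by simp only [VV_conj]
  have hRp : ∀ i, (R i i).PosSemidef := fun i => hpsd.conjTranspose_mul_mul_same _
  have hRt : ∀ i, (((R i i).trace.re : ℝ) : ℂ) = (R i i).trace := fun i =>
    (Complex.eq_re_of_ofReal_le (r := 0) (by simpa using (hRp i).trace_nonneg)).symm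
  have hRn : ∀ i, 0 ≤ (R i i).trace.re := fun i =>
    (Complex.le_def.mp (hRp i).trace_nonneg).1
  have hsum : ∑ i, (R i i).trace = 1 := by
    rw [← htr]
    conv_rhs => rw [hdec]
    rw [trace_sum]
    refine Finset.sum_congr rfl fun i _ => ?_
    rw [trace_kronecker, proj, trace_vecMulVec, dotProduct_comm, horth]
    simp
  have hne : Nonempty (Fin dA) := by
    by_contra hn
    rw [not_nonempty_iff] at hn
    simp [Matrix.trace] at htr
  obtain ⟨a0⟩ := hne
  refine ⟨fun i => (R i i).trace.re, fun i => if (R i i).trace = 0 then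
    diagonal (Pi.single a0 1) else ((R i i).trace)⁻¹ • R i i, hRn, ?_, ?_, ?_⟩
  · have := congrArg Complex.re hsum
    simpa using this
  · intro i
    dsimp only
    split_ifs with h
    · refine ⟨PosSemidef.diagonal ?_, by simp [trace_diagonal]⟩
      exact Pi.single_nonneg.mpr zero_le_one
    · refine ⟨(hRp i).smul ?_, by simp [h]⟩
      exact inv_nonneg.mpr (hRp i).trace_nonneg
  · conv_lhs => rw [hdec]
    refine Finset.sum_congr rfl fun i _ => ?_
    dsimp only
    rw [hRt]
    split_ifs with h
    · rw [h, zero_smul, (hRp i).trace_eq_zero_iff.mp h, zero_kronecker]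
    · rw [smul_kronecker, smul_smul, mul_inv_cancel₀ h, one_smul]
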